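/- arXiv:0804.2093 — 5 statements merged into one kernel-verified Lean document; each statement's English description precedes it below -/
import Mathlib

section
/- Let ξ, η, ν be real numbers with η > 0 and ν ≥ 0, and ζ ∈ ℂ with |ζ|² ≤ ν(ν+η). Let L be the Lindblad generator on M₂ defined using these parameters and the matrix D = [[0,0],[1,0]]. Then for every density matrix ρ and all t ≥ 0, the matrix ρ_t = e^{tL}(ρ) satisfies u₃(ρ_t) = e^{−(2ν+η)t} ( u₃(ρ) + η/(2ν+η) ) − η/(2ν+η). -/
open scoped ComplexOrder
open Filter Topology Matrix

noncomputable section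

abbrev M2 := Matrix (Fin 2) (Fin 2) ℂ

def σ₁ : M2 := !![0, 1; 1, 0]
def σ₂ : M2 := !![0, -Complex.I; Complex.I, 0]
def σ₃ : M2 := !![1, 0; 0, -1]

/-- The matrix `D = [[0,0],[1,0]]`. -/
def Dm : M2 := !![0, 0; 1, 0]

def u₁ (ρ : M2) : ℂ := (ρ * σ₁).trace
def u₂ (ρ : M2) : ℂ := (ρ * σ₂).trace
def u₃ (ρ : M2) : ℂ := (ρ * σ₃).trace

def IsDensity (ρ : M2) : Prop := ρ.PosSemidef ∧ ρ.trace = 1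

/-- The Lindblad generator with parameters `ξ, η, ν, ζ` and `D = [[0,0],[1,0]]`. -/
def IsLindblad (ξ η ν : ℝ) (ζ : ℂ) (L : M2 →ₗ[ℂ] M2) : Prop :=
  ∀ ρ : M2, L ρ =
    (Complex.I * (ξ : ℂ)) • ((Dm * Dmᴴ - Dmᴴ * Dm) * ρ - ρ * (Dm * Dmᴴ - Dmᴴ * Dm))
    - (((ν + η) / 2 : ℝ) : ℂ) • (Dmᴴ * Dm * ρ - 2 * (Dm * ρ * Dmᴴ) + ρ * (Dmᴴ * Dm))
    - ((ν / 2 : ℝ) : ℂ) • (Dm * Dmᴴ * ρ - 2 * (Dmᴴ * ρ * Dm) + ρ * (Dm * Dmᴴ))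
    + (starRingEnd ℂ ζ) • (Dm * ρ * Dm) + ζ • (Dmᴴ * ρ * Dmᴴ)

/-- `S t = e^{tL}`, characterized as the solution of the associated linear ODE. -/
def IsExpSemigroup (L : M2 →ₗ[ℂ] M2) (S : ℝ → M2 →ₗ[ℂ] M2) : Prop :=
  S 0 = LinearMap.id ∧
  ∀ (ρ : M2) (i j : Fin 2) (t : ℝ),
    HasDerivAt (fun s => S s ρ i j) ((L (S t ρ)) i j) t
theorem statement14 (ξ η ν : ℝ) (ζ : ℂ) (hη : 0 < η) (hν : 0 ≤ ν)
    (hζ : Complex.normSq ζ ≤ ν * (ν + η))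
    (L : M2 →ₗ[ℂ] M2) (hL : IsLindblad ξ η ν ζ L)
    (S : ℝ → M2 →ₗ[ℂ] M2) (hS : IsExpSemigroup L S) :
    ∀ ρ : M2, IsDensity ρ → ∀ t : ℝ, 0 ≤ t →
      u₃ (S t ρ) = (Real.exp (-(2 * ν + η) * t) : ℂ) * (u₃ ρ + ((η / (2 * ν + η) : ℝ) : ℂ))
        - ((η / (2 * ν + η) : ℝ) : ℂ) := by
  intro ρ hρ t _
  obtain ⟨h0, hd⟩ := hS
  have hu : ∀ A : M2, u₃ A = A 0 0 - A 1 1 := by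
    intro A
    simp [u₃, σ₃, Matrix.trace, Fin.sum_univ_two, Matrix.mul_apply]
    ring
  have d00 : Dm 0 0 = 0 := by simp [Dm]
  have d01 : Dm 0 1 = 0 := by simp [Dm]
  have d10 : Dm 1 0 = 1 := by simp [Dm]
  have d11 : Dm 1 1 = 0 := by simp [Dm]
  have hL0 : ∀ A : M2, L A 0 0 = -((ν : ℂ) + η) * A 0 0 + ν * A 1 1 := by
    intro A
    rw [hL A, two_mul, two_mul]
    simp [Matrix.mul_apply, Fin.sum_univ_two, d00, d01, d10, d11]
    ring
  have hL1 : ∀ A : M2, L A 1 1 = ((ν : ℂ) + η) * A 0 0 - ν * A 1 1 := by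
    intro A
    rw [hL A, two_mul, two_mul]
    simp [Matrix.mul_apply, Fin.sum_univ_two, d00, d01, d10, d11]
    ring
  have hconst : ∀ f : ℝ → ℂ, (∀ s, HasDerivAt f 0 s) → f t = f 0 := by
    intro f hf
    exact is_const_of_deriv_eq_zero (fun s => (hf s).differentiableAt) (fun s => (hf s).deriv) t 0
  have htr : ∀ s, S s ρ 0 0 + S s ρ 1 1 = 1 := by
    intro s
    have h := is_const_of_deriv_eq_zero (𝕜 := ℝ) (f := fun s => S s ρ 0 0 + S s ρ 1 1)
      (fun s => ((hd ρ 0 0 s).add (hd ρ 1 1 s)).differentiableAt)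
      (fun s => by
        refine ((hd ρ 0 0 s).add (hd ρ 1 1 s)).deriv.trans ?_
        rw [hL0, hL1]; ring) s 0
    have h2 := hρ.2
    simp only [Matrix.trace, Fin.sum_univ_two, Matrix.diag_apply] at h2
    simp only [h0, LinearMap.id_apply] at h
    rw [h, h2]
  have hk : (2 * (ν : ℂ) + η) ≠ 0 := by
    have : (2 * ν + η : ℝ) ≠ 0 := by positivity
    exact_mod_cast this
  have hexp : ∀ s : ℝ, HasDerivAt (fun s : ℝ => Complex.exp ((2 * (ν : ℂ) + η) * s))
      (Complex.exp ((2 * (ν : ℂ) + η) * s) * ((2 * (ν : ℂ) + η) * 1)) s := by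
    intro s
    exact (((hasDerivAt_id s).ofReal_comp).const_mul (2 * (ν : ℂ) + η)).cexp
  have key := hconst (fun s : ℝ => Complex.exp ((2 * (ν : ℂ) + η) * s) *
      ((S s ρ 0 0 - S s ρ 1 1) + (η : ℂ) / (2 * (ν : ℂ) + η))) (by
    intro s
    refine ((hexp s).mul (((hd ρ 0 0 s).sub (hd ρ 1 1 s)).add_const _)).congr_deriv ?_
    rw [hL0, hL1]
    have h1 : S s ρ 1 1 = 1 - S s ρ 0 0 := by rw [← htr s]; ring
    simp only [Pi.sub_apply, h1]
    field_simp
    ring)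
  simp only [h0, LinearMap.id_apply, Complex.ofReal_zero, mul_zero, Complex.exp_zero,
    one_mul] at key
  rw [hu, hu]
  push_cast
  rw [← key, ← mul_assoc, ← Complex.exp_add]
  have h1 : -(2 * (ν : ℂ) + η) * t + (2 * (ν : ℂ) + η) * t = 0 := by ring
  rw [h1, Complex.exp_zero]
  ring
end
end

section
/- Let ξ, η, ν be real numbers with η > 0 and ν ≥ 0, and ζ ∈ ℂ with |ζ|² ≤ ν(ν+η), and suppose |ζ|² − 4ξ² > 0. Let L be the Lindblad generator on M₂ defined using these parameters and D = [[0,0],[1,0]], and set m₁ = −(ν + η/2) + √(|ζ|² − 4ξ²), m₂ = −(ν + η/2) − √(|ζ|² − 4ξ²). Then there exist constants a₁, a₂, b₁, b₂, c₁, c₂, d₁, d₂ (independent of ρ and t) such that for every density matrix ρ and all t ≥ 0, ρ_t = e^{tL}(ρ) satisfies u₁(ρ_t) = e^{m₁t}(a₁u₁(ρ) + b₁u₂(ρ)) + e^{m₂t}(a₂u₁(ρ) + b₂u₂(ρ)) and u₂(ρ_t) = e^{m₁t}(c₁u₁(ρ) + d₁u₂(ρ)) + e^{m₂t}(c₂u₁(ρ)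 + d₂u₂(ρ)). -/
open scoped ComplexOrder
open Filter Topology Matrix

noncomputable section

theorem exp_ode_aux (f : ℝ → ℂ) (m : ℝ) (h : ∀ t, HasDerivAt f ((m : ℂ) * f t) t) (t : ℝ) :
    f t = (Real.exp (m * t) : ℂ) * f 0 := by
  have hE : ∀ t : ℝ, HasDerivAt (fun s : ℝ => (Real.exp (-m * s) : ℂ))
      ((Real.exp (-m * t) * (-m) : ℝ) : ℂ) t := by
    intro t
    have h1 : HasDerivAt (fun s : ℝ => -m * s) (-m) t := by
      simpa using (hasDerivAt_id t).const_mul (-m)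
    exact h1.exp.ofReal_comp
  have hg : ∀ t : ℝ, HasDerivAt (fun s : ℝ => (Real.exp (-m * s) : ℂ) * f s) 0 t := by
    intro t
    refine ((hE t).fun_mul (h t)).congr_deriv ?_
    push_cast
    ring
  have hc := is_const_of_deriv_eq_zero (fun t => (hg t).differentiableAt)
    (fun t => (hg t).deriv) t 0
  simp only [mul_zero, Real.exp_zero, Complex.ofReal_one, one_mul] at hc
  rw [← hc, ← mul_assoc, ← Complex.ofReal_mul, ← Real.exp_add]
  simp

theorem statement15 (ξ η ν : ℝ) (ζ : ℂ) (hη : 0 < η) (hν : 0 ≤ ν)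
    (hζ : Complex.normSq ζ ≤ ν * (ν + η))
    (hdisc : 0 < Complex.normSq ζ - 4 * ξ ^ 2)
    (L : M2 →ₗ[ℂ] M2) (hL : IsLindblad ξ η ν ζ L)
    (S : ℝ → M2 →ₗ[ℂ] M2) (hS : IsExpSemigroup L S)
    (m₁ m₂ : ℝ)
    (hm₁ : m₁ = -(ν + η / 2) + Real.sqrt (Complex.normSq ζ - 4 * ξ ^ 2))
    (hm₂ : m₂ = -(ν + η / 2) - Real.sqrt (Complex.normSq ζ - 4 * ξ ^ 2)) :
    ∃ a₁ a₂ b₁ b₂ c₁ c₂ d₁ d₂ : ℝ,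
      ∀ ρ : M2, IsDensity ρ → ∀ t : ℝ, 0 ≤ t →
        u₁ (S t ρ) = (Real.exp (m₁ * t) : ℂ) * ((a₁ : ℂ) * u₁ ρ + (b₁ : ℂ) * u₂ ρ)
            + (Real.exp (m₂ * t) : ℂ) * ((a₂ : ℂ) * u₁ ρ + (b₂ : ℂ) * u₂ ρ) ∧
        u₂ (S t ρ) = (Real.exp (m₁ * t) : ℂ) * ((c₁ : ℂ) * u₁ ρ + (d₁ : ℂ) * u₂ ρ)
            + (Real.exp (m₂ * t) : ℂ) * ((c₂ : ℂ) * u₁ ρ + (d₂ : ℂ) * u₂ ρ) := by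
  obtain ⟨hS0, hS1⟩ := hS
  set s := Real.sqrt (Complex.normSq ζ - 4 * ξ ^ 2) with hs
  have hspos : 0 < s := Real.sqrt_pos.mpr hdisc
  have hs2 : s ^ 2 = ζ.re ^ 2 + ζ.im ^ 2 - 4 * ξ ^ 2 := by
    rw [hs, Real.sq_sqrt hdisc.le, Complex.normSq_apply]; ring
  have hu1 : ∀ ρ : M2, u₁ ρ = ρ 0 1 + ρ 1 0 := by
    intro ρ
    simp [u₁, σ₁, Matrix.trace_fin_two, Matrix.mul_apply, Fin.sum_univ_two]
  have hu2 : ∀ ρ : M2, u₂ ρ = Complex.I * (ρ 0 1 - ρ 1 0) := by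
    intro ρ
    simp [u₂, σ₂, Matrix.trace_fin_two, Matrix.mul_apply, Fin.sum_univ_two]
    ring
  have hD : Dmᴴ = !![0, 1; 0, 0] := by
    ext i j; fin_cases i <;> fin_cases j <;> simp [Dm]
  have hL01 : ∀ ρ : M2, L ρ 0 1 =
      (-((ν : ℂ) + η / 2) - 2 * Complex.I * ξ) * ρ 0 1 + (ζ.re + ζ.im * Complex.I) * ρ 1 0 := by
    intro ρ
    rw [hL ρ, hD, two_mul, two_mul, Complex.re_add_im, Matrix.eta_fin_two ρ]
    simp [Dm]
    ring
  have hL10 : ∀ ρ : M2, L ρ 1 0 =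
      (-((ν : ℂ) + η / 2) + 2 * Complex.I * ξ) * ρ 1 0 + (ζ.re - ζ.im * Complex.I) * ρ 0 1 := by
    intro ρ
    have hc : (ζ.re - ζ.im * Complex.I : ℂ) = starRingEnd ℂ ζ := by
      apply Complex.ext <;> simp
    rw [hL ρ, hD, two_mul, two_mul, hc, Matrix.eta_fin_two ρ]
    simp [Dm]
    ring
  have hd1 : ∀ (ρ : M2) (t : ℝ), HasDerivAt (fun r => u₁ (S r ρ))
      ((-((ν : ℂ) + η / 2) + ζ.re) * u₁ (S t ρ) + (-2 * ξ - ζ.im) * u₂ (S t ρ)) t := by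
    intro ρ t
    simp only [hu1, hu2]
    refine ((hS1 ρ 0 1 t).fun_add (hS1 ρ 1 0 t)).congr_deriv ?_
    rw [hL01, hL10]
    ring
  have hd2 : ∀ (ρ : M2) (t : ℝ), HasDerivAt (fun r => u₂ (S r ρ))
      ((2 * ξ - ζ.im) * u₁ (S t ρ) + (-((ν : ℂ) + η / 2) - ζ.re) * u₂ (S t ρ)) t := by
    intro ρ t
    simp only [hu1, hu2]
    refine (((hS1 ρ 0 1 t).fun_sub (hS1 ρ 1 0 t)).const_mul Complex.I).congr_deriv ?_
    rw [hL01, hL10]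
    linear_combination (-2 * ξ * (S t ρ 0 1 + S t ρ 1 0) + ζ.im * (S t ρ 0 1 + S t ρ 1 0)) *
      Complex.I_sq
  have hs2c : (s : ℂ) ^ 2 = (ζ.re : ℂ) ^ 2 + (ζ.im : ℂ) ^ 2 - 4 * (ξ : ℂ) ^ 2 := by
    exact_mod_cast hs2
  have hs0 : (s : ℂ) ≠ 0 := by exact_mod_cast hspos.ne'
  have key : ∀ (e : ℝ), e ^ 2 = 1 → ∀ (ρ : M2) (t : ℝ),
      (((e * s : ℝ) : ℂ) + ζ.re) * u₁ (S t ρ) + (-2 * ξ - ζ.im) * u₂ (S t ρ) =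
        (Real.exp ((-(ν + η / 2) + e * s) * t) : ℂ) *
          ((((e * s : ℝ) : ℂ) + ζ.re) * u₁ ρ + (-2 * ξ - ζ.im) * u₂ ρ) ∧
      (2 * ξ - ζ.im) * u₁ (S t ρ) + (((e * s : ℝ) : ℂ) - ζ.re) * u₂ (S t ρ) =
        (Real.exp ((-(ν + η / 2) + e * s) * t) : ℂ) *
          ((2 * ξ - ζ.im) * u₁ ρ + (((e * s : ℝ) : ℂ) - ζ.re) * u₂ ρ) := by
    intro e he ρ t
    have hec : (e : ℂ) ^ 2 = 1 := by exact_mod_cast he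
    have hes : ((e : ℂ) * s) ^ 2 = (ζ.re : ℂ) ^ 2 + (ζ.im : ℂ) ^ 2 - 4 * (ξ : ℂ) ^ 2 := by
      rw [mul_pow, hec, one_mul, hs2c]
    have h0 : S 0 ρ = ρ := by rw [hS0]; rfl
    constructor
    · have := exp_ode_aux (fun t => (((e * s : ℝ) : ℂ) + ζ.re) * u₁ (S t ρ)
        + (-2 * ξ - ζ.im) * u₂ (S t ρ)) (-(ν + η / 2) + e * s) (by
          intro t
          refine (((hd1 ρ t).const_mul (((e * s : ℝ) : ℂ) + ζ.re)).fun_add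
            ((hd2 ρ t).const_mul (-2 * ξ - ζ.im : ℂ))).congr_deriv ?_
          push_cast
          linear_combination -u₁ (S t ρ) * hes) t
      simpa only [h0] using this
    · have := exp_ode_aux (fun t => (2 * ξ - ζ.im) * u₁ (S t ρ)
        + (((e * s : ℝ) : ℂ) - ζ.re) * u₂ (S t ρ)) (-(ν + η / 2) + e * s) (by
          intro t
          refine (((hd1 ρ t).const_mul (2 * ξ - ζ.im : ℂ)).fun_add
            ((hd2 ρ t).const_mul (((e * s : ℝ) : ℂ) - ζ.re))).congr_deriv ?_
          push_cast
          linear_combination -u₂ (S t ρ) * hes) t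
      simpa only [h0] using this
  refine ⟨(s + ζ.re) / (2 * s), (s - ζ.re) / (2 * s), (-2 * ξ - ζ.im) / (2 * s),
    -(-2 * ξ - ζ.im) / (2 * s), (2 * ξ - ζ.im) / (2 * s), -(2 * ξ - ζ.im) / (2 * s),
    (s - ζ.re) / (2 * s), (s + ζ.re) / (2 * s), ?_⟩
  intro ρ _ t _
  obtain ⟨p1, p2⟩ := key 1 (by norm_num) ρ t
  obtain ⟨q1, q2⟩ := key (-1) (by norm_num) ρ t
  have e1 : -(ν + η / 2) + 1 * s = m₁ := by rw [hm₁]; ring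
  have e2 : -(ν + η / 2) + -1 * s = m₂ := by rw [hm₂]; ring
  rw [e1] at p1 p2
  rw [e2] at q1 q2
  generalize (Real.exp (m₁ * t) : ℂ) = E1 at *
  generalize (Real.exp (m₂ * t) : ℂ) = E2 at *
  push_cast at p1 p2 q1 q2 ⊢
  constructor
  · field_simp
    linear_combination p1 - q1
  · field_simp
    linear_combination p2 - q2
end
end

section
/- Let ξ, η, ν be real numbers with η > 0 and ν ≥ 0, and ζ ∈ ℂ with |ζ|² ≤ ν(ν+η), and suppose |ζ|² − 4ξ² < 0. Let L be the Lindblad generator on M₂ defined using these parameters and D = [[0,0],[1,0]], and set m = −(ν + η/2) and w = √(4ξ² − |ζ|²). Then there exist constants a₁, a₂, b₁, b₂, c₁, c₂, d₁, d₂ (independent of ρ and t) such that for every density matrix ρ and all t ≥ 0, ρ_t = e^{tL}(ρ) satisfies u₁(ρ_t) = e^{mt}((a₁u₁(ρ) + b₁u₂(ρ)) cos(tw) + (a₂u₁(ρ) + b₂u₂(ρ)) sin(tw)) and u₂(ρ_t) = e^{mt}((c₁u₁(ρ) + d₁u₂(ρ)) cos(tw) + (c₂u₁(ρ) + d₂u₂(ρ))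 sin(tw)). -/
open scoped ComplexOrder
open Filter Topology Matrix

noncomputable section

lemma const_of_deriv_zero (F : ℝ → ℂ) (h : ∀ t, HasDerivAt F 0 t) (t : ℝ) : F t = F 0 :=
  is_const_of_deriv_eq_zero (fun t => (h t).differentiableAt) (fun t => (h t).deriv) t 0

lemma osc_invariant (x y : ℝ → ℂ) (m p k l w : ℝ) (hw : w ≠ 0) (hq : w ^ 2 = k * l - p ^ 2)
    (hx : ∀ t, HasDerivAt x ((m + p) * x t - k * y t) t)
    (hy : ∀ t, HasDerivAt y (l * x t + (m - p) * y t) t) (t : ℝ) :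
    (Real.exp (-m * t) : ℂ) * ((Real.cos (t * w) : ℂ) * x t
      - (Real.sin (t * w) : ℂ) * ((p * x t - k * y t) / w)) = x 0 := by
  have hwc : (w : ℂ) ≠ 0 := by exact_mod_cast hw
  have hqc : (w : ℂ) ^ 2 = k * l - p ^ 2 := by exact_mod_cast hq
  have key := const_of_deriv_zero (fun t => (Real.exp (-m * t) : ℂ) * ((Real.cos (t * w) : ℂ) * x t
      - (Real.sin (t * w) : ℂ) * ((p * x t - k * y t) / w))) (fun t => ?_) t
  · rw [key]; simp
  have he : HasDerivAt (fun t : ℝ => (Real.exp (-m * t) : ℂ))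
      ((Real.exp (-m * t) * (-m * 1) : ℝ) : ℂ) t :=
    (((hasDerivAt_id t).const_mul (-m)).exp).ofReal_comp
  have hc : HasDerivAt (fun t : ℝ => (Real.cos (t * w) : ℂ))
      ((-Real.sin (t * w) * (1 * w) : ℝ) : ℂ) t :=
    (((hasDerivAt_id t).mul_const w).cos).ofReal_comp
  have hs : HasDerivAt (fun t : ℝ => (Real.sin (t * w) : ℂ))
      ((Real.cos (t * w) * (1 * w) : ℝ) : ℂ) t :=
    (((hasDerivAt_id t).mul_const w).sin).ofReal_comp
  have hN := (((hx t).const_mul (p : ℂ)).sub ((hy t).const_mul (k : ℂ))).div_const (w : ℂ)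
  have hall := he.mul ((hc.mul (hx t)).sub (hs.mul hN))
  refine hall.congr_deriv ?_
  simp only [Pi.mul_apply, Pi.sub_apply]
  push_cast
  generalize Complex.exp (-↑m * ↑t) = e
  generalize Complex.cos (↑t * ↑w) = c
  generalize Complex.sin (↑t * ↑w) = s
  generalize x t = X
  generalize y t = Y
  field_simp
  linear_combination (-e * s * X) * hqc

lemma osc_solution (x y : ℝ → ℂ) (m p k l w : ℝ) (hw : w ≠ 0) (hq : w ^ 2 = k * l - p ^ 2)
    (hx : ∀ t, HasDerivAt x ((m + p) * x t - k * y t) t)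
    (hy : ∀ t, HasDerivAt y (l * x t + (m - p) * y t) t) (t : ℝ) :
    x t = (Real.exp (m * t) : ℂ) * (x 0 * (Real.cos (t * w) : ℂ)
      + ((p * x 0 - k * y 0) / w) * (Real.sin (t * w) : ℂ)) := by
  have hwc : (w : ℂ) ≠ 0 := by exact_mod_cast hw
  have hqc : (w : ℂ) ^ 2 = k * l - p ^ 2 := by exact_mod_cast hq
  have h1 := osc_invariant x y m p k l w hw hq hx hy t
  have h2 := osc_invariant y x m (-p) (-l) (-k) w hw (by rw [hq]; ring)
    (fun t => (hy t).congr_deriv (by push_cast; ring))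
    (fun t => (hx t).congr_deriv (by push_cast; ring)) t
  have hee : (Real.exp (m * t) : ℂ) * (Real.exp (-m * t) : ℂ) = 1 := by
    rw [← Complex.ofReal_mul, ← Real.exp_add]; simp
  have hcs : (Real.sin (t * w) : ℂ) ^ 2 + (Real.cos (t * w) : ℂ) ^ 2 = 1 := by
    exact_mod_cast Real.sin_sq_add_cos_sq (t * w)
  rw [← h1, ← h2]
  simp only [Complex.ofReal_neg]
  revert hee hcs
  generalize (Real.exp (m * t) : ℂ) = e
  generalize (Real.exp (-m * t) : ℂ) = e'
  generalize (Real.cos (t * w) : ℂ) = c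
  generalize (Real.sin (t * w) : ℂ) = s
  generalize x t = X
  generalize y t = Y
  intro hee hcs
  have : X = (e * e') * ((s ^ 2 + c ^ 2) * X) := by rw [hee, hcs]; ring
  field_simp
  linear_combination ((w : ℂ) ^ 2) * this + (e * e' * s ^ 2 * X) * hqc

theorem statement16 (ξ η ν : ℝ) (ζ : ℂ) (hη : 0 < η) (hν : 0 ≤ ν)
    (hζ : Complex.normSq ζ ≤ ν * (ν + η))
    (hdisc : Complex.normSq ζ - 4 * ξ ^ 2 < 0)
    (L : M2 →ₗ[ℂ] M2) (hL : IsLindblad ξ η ν ζ L)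
    (S : ℝ → M2 →ₗ[ℂ] M2) (hS : IsExpSemigroup L S)
    (m w : ℝ) (hm : m = -(ν + η / 2)) (hw : w = Real.sqrt (4 * ξ ^ 2 - Complex.normSq ζ)) :
    ∃ a₁ a₂ b₁ b₂ c₁ c₂ d₁ d₂ : ℝ,
      ∀ ρ : M2, IsDensity ρ → ∀ t : ℝ, 0 ≤ t →
        u₁ (S t ρ) = (Real.exp (m * t) : ℂ) *
            (((a₁ : ℂ) * u₁ ρ + (b₁ : ℂ) * u₂ ρ) * (Real.cos (t * w) : ℂ)
              + ((a₂ : ℂ) * u₁ ρ + (b₂ : ℂ) * u₂ ρ) * (Real.sin (t * w) : ℂ)) ∧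
        u₂ (S t ρ) = (Real.exp (m * t) : ℂ) *
            (((c₁ : ℂ) * u₁ ρ + (d₁ : ℂ) * u₂ ρ) * (Real.cos (t * w) : ℂ)
              + ((c₂ : ℂ) * u₁ ρ + (d₂ : ℂ) * u₂ ρ) * (Real.sin (t * w) : ℂ)) := by
  have hpos : 0 < 4 * ξ ^ 2 - Complex.normSq ζ := by linarith
  have hw0 : w ≠ 0 := by rw [hw]; exact (Real.sqrt_pos.mpr hpos).ne'
  have hwsq : w ^ 2 = (ζ.im + 2 * ξ) * (2 * ξ - ζ.im) - ζ.re ^ 2 := by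
    rw [hw, Real.sq_sqrt hpos.le, Complex.normSq_apply]; ring
  have hwc : (w : ℂ) ≠ 0 := by exact_mod_cast hw0
  refine ⟨1, ζ.re / w, 0, -(ζ.im + 2 * ξ) / w, 0, (2 * ξ - ζ.im) / w, 1, -ζ.re / w, ?_⟩
  intro ρ _ t _
  obtain ⟨hS0, hSd⟩ := hS
  have e1 : ∀ A : M2, u₁ A = A 0 1 + A 1 0 := by
    intro A; simp [u₁, σ₁, Matrix.trace, Matrix.mul_apply, Fin.sum_univ_two]
  have e2 : ∀ A : M2, u₂ A = Complex.I * (A 0 1 - A 1 0) := by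
    intro A; simp [u₂, σ₂, Matrix.trace, Matrix.mul_apply, Fin.sum_univ_two]; ring
  have hmc : (m : ℂ) = -(ν + η / 2) := by rw [hm]; push_cast; ring
  have two01 : ∀ B : M2, ((2 : M2) * B) = B + B := fun B => two_mul B
  have l01 : ∀ A : M2, L A 0 1 = (m - 2 * Complex.I * ξ) * A 0 1 + ζ * A 1 0 := by
    intro A
    rw [hL, hmc, two01, two01]
    simp [Dm, Matrix.mul_apply, Fin.sum_univ_two, Matrix.vecMul, Matrix.vecHead, Matrix.conjTranspose_apply]
    ring
  have l10 : ∀ A : M2, L A 1 0 =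
      (m + 2 * Complex.I * ξ) * A 1 0 + (starRingEnd ℂ ζ) * A 0 1 := by
    intro A
    rw [hL, hmc, two01, two01]
    simp [Dm, Matrix.mul_apply, Fin.sum_univ_two, Matrix.vecMul, Matrix.vecHead, Matrix.conjTranspose_apply]
    ring
  have hz : ζ = ζ.re + ζ.im * Complex.I := (Complex.re_add_im ζ).symm
  have hzc : (starRingEnd ℂ ζ) = ζ.re - ζ.im * Complex.I := by
    apply Complex.ext <;> simp
  have hx : ∀ t, HasDerivAt (fun t => u₁ (S t ρ))
      ((m + ζ.re) * u₁ (S t ρ) - ((ζ.im + 2 * ξ : ℝ) : ℂ) * u₂ (S t ρ)) t := by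
    intro t
    simp only [e1, e2]
    refine ((hSd ρ 0 1 t).add (hSd ρ 1 0 t)).congr_deriv ?_
    rw [l01, l10, hzc]
    push_cast
    linear_combination (S t ρ 1 0) * hz
  have hy : ∀ t, HasDerivAt (fun t => u₂ (S t ρ))
      (((2 * ξ - ζ.im : ℝ) : ℂ) * u₁ (S t ρ) + (m - ζ.re) * u₂ (S t ρ)) t := by
    intro t
    simp only [e1, e2]
    refine (((hSd ρ 0 1 t).sub (hSd ρ 1 0 t)).const_mul Complex.I).congr_deriv ?_
    rw [l01, l10, hzc]
    push_cast
    linear_combination (Complex.I * S t ρ 1 0) * hz +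
      ((-2 * ξ + ζ.im) * (S t ρ 0 1 + S t ρ 1 0)) * Complex.I_sq
  have s1 := osc_solution _ _ m _ _ _ w hw0 hwsq hx hy t
  have s2 := osc_solution (fun t => u₂ (S t ρ)) (fun t => u₁ (S t ρ)) m (-ζ.re) (-(2 * ξ - ζ.im))
    (-(ζ.im + 2 * ξ)) w hw0 (by rw [hwsq]; ring)
    (fun t => (hy t).congr_deriv (by push_cast; ring))
    (fun t => (hx t).congr_deriv (by push_cast; ring)) t
  simp only [hS0, LinearMap.id_apply] at s1 s2
  constructor
  · rw [s1]; push_cast; field_simp; ring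
  · rw [s2]; push_cast; field_simp; ring
end
end

section
/- Let ξ, η, ν be real numbers with η > 0 and ν ≥ 0, and ζ ∈ ℂ with |ζ|² ≤ ν(ν+η). Let L be the Lindblad generator on M₂ defined using these parameters and D = [[0,0],[1,0]]. Then the density matrix ρ_∞ = ½(I − (η/(2ν+η))σ₃) is absorbing for the semigroup (e^{tL})_{t≥0}: for every density matrix ρ, lim_{t→∞} e^{tL}(ρ) = ρ_∞. -/
open scoped ComplexOrder
open Filter Topology Matrix

noncomputable section

theorem dm_conj : Dmᴴ = !![0, 1; 0, 0] := by
  ext i j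
  fin_cases i <;> fin_cases j <;> simp [Dm]

theorem decay_aux (κ : ℝ) (hκ : 0 < κ) (f f' : ℝ → ℝ) (hf : ∀ t, HasDerivAt f (f' t) t)
    (h0 : ∀ t, 0 ≤ f t) (hle : ∀ t, f' t ≤ -κ * f t) : Tendsto f atTop (𝓝 0) := by
  have hd : ∀ t, HasDerivAt (fun s => Real.exp (κ * s) * f s)
      (Real.exp (κ * t) * κ * f t + Real.exp (κ * t) * f' t) t := by
    intro t
    have h1 : HasDerivAt (fun s : ℝ => κ * s) κ t := by
      simpa using (hasDerivAt_id t).const_mul κ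
    exact h1.exp.mul (hf t)
  have hanti : Antitone (fun s => Real.exp (κ * s) * f s) := by
    apply antitone_of_deriv_nonpos (fun t => (hd t).differentiableAt)
    intro t
    rw [(hd t).deriv]
    have := mul_le_mul_of_nonneg_left (hle t) (Real.exp_pos (κ * t)).le
    nlinarith
  have hlim : Tendsto (fun t : ℝ => f 0 * Real.exp (-(κ * t))) atTop (𝓝 0) := by
    have h2 : Tendsto (fun t : ℝ => κ * t) atTop atTop := tendsto_id.const_mul_atTop hκ
    simpa using (Real.tendsto_exp_neg_atTop_nhds_zero.comp h2).const_mul (f 0)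
  refine tendsto_of_tendsto_of_tendsto_of_le_of_le' tendsto_const_nhds hlim
    (Eventually.of_forall h0) ?_
  filter_upwards [eventually_ge_atTop (0 : ℝ)] with t ht
  have h3 := hanti ht
  simp only [mul_zero, Real.exp_zero, one_mul] at h3
  rw [Real.exp_neg, ← div_eq_mul_inv, le_div_iff₀ (Real.exp_pos _)]
  linarith

theorem tendsto_zero_of_normsq (g : ℝ → ℂ) (h : Tendsto (fun t => ‖g t‖ ^ 2) atTop (𝓝 0)) :
    Tendsto g atTop (𝓝 0) := by
  rw [tendsto_zero_iff_norm_tendsto_zero]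
  have := h.sqrt
  simpa using this

theorem statement17 (ξ η ν : ℝ) (ζ : ℂ) (hη : 0 < η) (hν : 0 ≤ ν)
    (hζ : Complex.normSq ζ ≤ ν * (ν + η))
    (L : M2 →ₗ[ℂ] M2) (hL : IsLindblad ξ η ν ζ L)
    (S : ℝ → M2 →ₗ[ℂ] M2) (hS : IsExpSemigroup L S) :
    ∀ ρ : M2, IsDensity ρ →
      Tendsto (fun t => S t ρ) atTop
        (𝓝 ((1 / 2 : ℂ) • ((1 : M2) - ((η / (2 * ν + η) : ℝ) : ℂ) • σ₃))) := by
  intro ρ hρ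
  obtain ⟨hS0, hSd⟩ := hS
  have hk : 0 < 2 * ν + η := by linarith
  have hkc : (2 * ν + η : ℂ) ≠ 0 := by exact_mod_cast hk.ne'
  have e00 : ∀ X : M2, L X 0 0 = -(ν + η) * X 0 0 + ν * X 1 1 := by
    intro X
    rw [hL, dm_conj, Matrix.eta_fin_two X]
    simp [Dm, two_mul]
    ring
  have e11 : ∀ X : M2, L X 1 1 = (ν + η) * X 0 0 - ν * X 1 1 := by
    intro X
    rw [hL, dm_conj, Matrix.eta_fin_two X]
    simp [Dm, two_mul]
    ring
  have e01 : ∀ X : M2, L X 0 1 = (-2 * Complex.I * ξ - (2 * ν + η) / 2) * X 0 1 + ζ * X 1 0 := by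
    intro X
    rw [hL, dm_conj, Matrix.eta_fin_two X]
    simp [Dm, two_mul]
    ring
  have e10 : ∀ X : M2, L X 1 0 =
      (2 * Complex.I * ξ - (2 * ν + η) / 2) * X 1 0 + starRingEnd ℂ ζ * X 0 1 := by
    intro X
    rw [hL, dm_conj, Matrix.eta_fin_two X]
    simp [Dm, two_mul]
    ring
  -- trace conservation
  have htr : ∀ t, S t ρ 0 0 + S t ρ 1 1 = 1 := by
    have hd : ∀ t, HasDerivAt (fun s => S s ρ 0 0 + S s ρ 1 1) 0 t := by
      intro t
      have h := (hSd ρ 0 0 t).add (hSd ρ 1 1 t)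
      rw [e00, e11] at h
      refine h.congr_deriv ?_
      ring
    intro t
    have h := is_const_of_deriv_eq_zero (fun t => (hd t).differentiableAt)
      (fun t => (hd t).deriv) t 0
    simp only [hS0, LinearMap.id_apply] at h
    rw [h, ← hρ.2, Matrix.trace_fin_two]
  -- diagonal part
  have hw : Tendsto (fun t => S t ρ 0 0 - ν / (2 * ν + η)) atTop (𝓝 0) := by
    apply tendsto_zero_of_normsq
    have hd : ∀ t, HasDerivAt (fun s => S s ρ 0 0 - (ν / (2 * ν + η) : ℂ))
        (((-(2 * ν + η) : ℝ)) • (S t ρ 0 0 - (ν / (2 * ν + η) : ℂ))) t := by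
      intro t
      have h := (hSd ρ 0 0 t).sub_const (ν / (2 * ν + η) : ℂ)
      rw [e00, eq_sub_of_add_eq' (htr t)] at h
      refine h.congr_deriv ?_
      rw [Complex.real_smul]
      push_cast
      field_simp
      ring
    refine decay_aux (2 * (2 * ν + η)) (by linarith) _ _ (fun t => (hd t).norm_sq)
      (fun t => by positivity) ?_
    intro t
    rw [inner_smul_right, real_inner_self_eq_norm_sq]
    linarith
  -- off-diagonal part
  have hz : 2 * ‖ζ‖ < 2 * ν + η := by
    rw [Complex.normSq_eq_norm_sq] at hζ
    apply lt_of_pow_lt_pow_left₀ 2 hk.le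
    nlinarith
  have hV : Tendsto (fun t => ‖S t ρ 0 1‖ ^ 2 + ‖S t ρ 1 0‖ ^ 2) atTop (𝓝 0) := by
    refine decay_aux (2 * ν + η - 2 * ‖ζ‖) (by linarith) _ _
      (fun t => ((hSd ρ 0 1 t).norm_sq).add ((hSd ρ 1 0 t).norm_sq))
      (fun t => by positivity) ?_
    intro t
    rw [e01, e10]
    generalize S t ρ 0 1 = b
    generalize S t ρ 1 0 = c
    have key : 2 * inner ℝ b ((-2 * Complex.I * ξ - (2 * ν + η) / 2) * b + ζ * c)
        + 2 * inner ℝ c ((2 * Complex.I * ξ - (2 * ν + η) / 2) * c + starRingEnd ℂ ζ * b)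
        = -(2 * ν + η) * (‖b‖ ^ 2 + ‖c‖ ^ 2) + 4 * inner ℝ b (ζ * c) := by
      simp only [← Complex.normSq_eq_norm_sq, Complex.inner, Complex.normSq_apply]
      simp
      ring
    have h1 : inner ℝ b (ζ * c) ≤ ‖b‖ * (‖ζ‖ * ‖c‖) := by
      have := real_inner_le_norm b (ζ * c)
      rwa [norm_mul] at this
    have h2 := mul_nonneg (norm_nonneg ζ) (sq_nonneg (‖b‖ - ‖c‖))
    rw [key]
    nlinarith
  have hb : Tendsto (fun t => S t ρ 0 1) atTop (𝓝 0) := by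
    apply tendsto_zero_of_normsq
    exact squeeze_zero (fun t => by positivity)
      (fun t => le_add_of_nonneg_right (by positivity)) hV
  have hc : Tendsto (fun t => S t ρ 1 0) atTop (𝓝 0) := by
    apply tendsto_zero_of_normsq
    exact squeeze_zero (fun t => by positivity)
      (fun t => le_add_of_nonneg_left (by positivity)) hV
  have ha : Tendsto (fun t => S t ρ 0 0) atTop (𝓝 (ν / (2 * ν + η))) := by
    simpa using hw.add_const (ν / (2 * ν + η) : ℂ)
  have hd : Tendsto (fun t => S t ρ 1 1) atTop (𝓝 (1 - ν / (2 * ν + η))) := by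
    have : (fun t => S t ρ 1 1) = fun t => 1 - S t ρ 0 0 := by
      funext t
      exact eq_sub_of_add_eq' (htr t)
    rw [this]
    exact ha.const_sub 1
  have hT : ((1 / 2 : ℂ) • ((1 : M2) - ((η / (2 * ν + η) : ℝ) : ℂ) • σ₃)) =
      !![(ν / (2 * ν + η) : ℂ), 0; 0, 1 - ν / (2 * ν + η)] := by
    rw [σ₃, Matrix.one_fin_two]
    ext i j
    fin_cases i <;> fin_cases j <;> simp <;> field_simp <;> ring
  rw [hT]
  refine tendsto_pi_nhds.2 fun i => tendsto_pi_nhds.2 fun j => ?_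
  fin_cases i <;> fin_cases j
  · exact ha
  · exact hb
  · exact hc
  · exact hd
end
end

section
/- Let ξ and η be real numbers with η > 0, and let L be the Lindblad generator on M₂ with parameters ξ, η, ν = 0, ζ = 0 and D = [[0,0],[1,0]], so that L(ρ) = iξ[DD† − D†D, ρ] − (η/2)(D†Dρ − 2DρD† + ρD†D). Let ρ_∞ = ½(I − σ₃) (a rank-one projection) and let T_t denote the dual semigroup, defined by tr(e^{tL}(ρ)x) = tr(ρ T_t(x)). Then for every density matrix ρ ≠ ρ_∞ and every nonzero orthogonal projection p ∈ M₂: lim_{t→∞}(1/t) log tr(ρ T_t(p)) = −η if p = I − ρ_∞, and lim_{t→∞}(1/t) log tr(ρ T_t(p)) = 0 otherwise. -/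
open scoped ComplexOrder
open Filter Topology Matrix

noncomputable section

theorem ode_aux (c : ℂ) (f : ℝ → ℂ) (hf : ∀ t, HasDerivAt f (c * f t) t) (t : ℝ) :
    f t = Complex.exp (c * t) * f 0 := by
  have hg : ∀ t : ℝ, HasDerivAt (fun s : ℝ => Complex.exp (-(c * s)) * f s) 0 t := by
    intro t
    have h1 : HasDerivAt (fun s : ℝ => (s : ℂ)) 1 t := Complex.ofRealCLM.hasDerivAt
    have h2 := ((h1.const_mul c).neg.cexp).mul (hf t)
    refine h2.congr_deriv ?_
    simp only [Pi.neg_apply]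
    ring
  have h := is_const_of_deriv_eq_zero (fun t => (hg t).differentiableAt)
    (fun t => (hg t).deriv) t 0
  simp only [Complex.ofReal_zero, mul_zero, neg_zero, Complex.exp_zero, one_mul] at h
  rw [← h, ← mul_assoc, ← Complex.exp_add]
  simp

theorem exp_aux (c : ℂ) (hc : c.re < 0) :
    Tendsto (fun t : ℝ => Complex.exp (c * t)) atTop (𝓝 0) := by
  rw [tendsto_zero_iff_norm_tendsto_zero]
  have : (fun t : ℝ => ‖Complex.exp (c * t)‖) = fun t : ℝ => Real.exp (c.re * t) := by
    funext t
    rw [Complex.norm_exp]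
    simp
  rw [this]
  exact Real.tendsto_exp_atBot.comp (tendsto_id.const_mul_atTop_of_neg hc)

theorem statement18 (ξ η : ℝ) (hη : 0 < η)
    (L : M2 →ₗ[ℂ] M2) (hL : IsLindblad ξ η 0 0 L)
    (S : ℝ → M2 →ₗ[ℂ] M2) (hS : IsExpSemigroup L S)
    -- `T` is the trace-dual semigroup of `e^{tL}`
    (T : ℝ → M2 →ₗ[ℂ] M2)
    (hT : ∀ t : ℝ, 0 ≤ t → ∀ ρ x : M2, ((S t ρ) * x).trace = (ρ * T t x).trace) :
    ∀ ρ : M2, IsDensity ρ → ρ ≠ (1 / 2 : ℂ) • ((1 : M2) - σ₃) →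
      ∀ p : M2, p ≠ 0 → p.IsHermitian → p * p = p →
        (p = (1 : M2) - (1 / 2 : ℂ) • ((1 : M2) - σ₃) →
          Tendsto (fun t => (1 / t) * Real.log ((ρ * T t p).trace.re))
            atTop (𝓝 (-η))) ∧
        (p ≠ (1 : M2) - (1 / 2 : ℂ) • ((1 : M2) - σ₃) →
          Tendsto (fun t => (1 / t) * Real.log ((ρ * T t p).trace.re))
            atTop (𝓝 0)) := by
  intro ρ hρ hne p hp0 hpH hpp
  obtain ⟨hS0, hSd⟩ := hS
  have hz : ∀ i j, S 0 ρ i j = ρ i j := by intro i j; rw [hS0]; rfl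
  have hDH : Dmᴴ = !![0, 1; 0, 0] := by
    ext i j
    fin_cases i <;> fin_cases j <;> simp [Dm]
  have l00 : ∀ x : M2, L x 0 0 = (-η : ℂ) * x 0 0 := by
    intro x
    rw [hL x, hDH]
    simp [Dm, Matrix.mul_apply, Matrix.vecMul, dotProduct, Fin.sum_univ_two, two_mul]
    ring
  have l11 : ∀ x : M2, L x 1 1 = (η : ℂ) * x 0 0 := by
    intro x
    rw [hL x, hDH]
    simp [Dm, Matrix.mul_apply, Matrix.vecMul, dotProduct, Fin.sum_univ_two, two_mul]
    ring
  have l01 : ∀ x : M2, L x 0 1 = (-2 * Complex.I * ξ - η / 2 : ℂ) * x 0 1 := by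
    intro x
    rw [hL x, hDH]
    simp [Dm, Matrix.mul_apply, Matrix.vecMul, dotProduct, Fin.sum_univ_two, two_mul]
    ring
  have l10 : ∀ x : M2, L x 1 0 = (2 * Complex.I * ξ - η / 2 : ℂ) * x 1 0 := by
    intro x
    rw [hL x, hDH]
    simp [Dm, Matrix.mul_apply, Matrix.vecMul, dotProduct, Fin.sum_univ_two, two_mul]
    ring
  have s00 : ∀ t : ℝ, S t ρ 0 0 = Complex.exp ((-η : ℂ) * t) * ρ 0 0 := by
    intro t
    rw [← hz]
    exact ode_aux _ (fun t => S t ρ 0 0) (fun t => by rw [← l00]; exact hSd ρ 0 0 t) t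
  have s01 : ∀ t : ℝ, S t ρ 0 1 = Complex.exp ((-2 * Complex.I * ξ - η / 2 : ℂ) * t) * ρ 0 1 := by
    intro t
    rw [← hz]
    exact ode_aux _ (fun t => S t ρ 0 1) (fun t => by rw [← l01]; exact hSd ρ 0 1 t) t
  have s10 : ∀ t : ℝ, S t ρ 1 0 = Complex.exp ((2 * Complex.I * ξ - η / 2 : ℂ) * t) * ρ 1 0 := by
    intro t
    rw [← hz]
    exact ode_aux _ (fun t => S t ρ 1 0) (fun t => by rw [← l10]; exact hSd ρ 1 0 t) t
  have htr : ρ 0 0 + ρ 1 1 = 1 := by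
    have := hρ.2
    rwa [Matrix.trace_fin_two] at this
  have s11 : ∀ t : ℝ, S t ρ 1 1 = 1 - S t ρ 0 0 := by
    intro t
    have h := ode_aux 0 (fun t => S t ρ 0 0 + S t ρ 1 1) (fun t => by
      have := (hSd ρ 0 0 t).add (hSd ρ 1 1 t)
      refine this.congr_deriv ?_
      rw [l00, l11]; ring) t
    simp only [hz, htr, zero_mul, Complex.exp_zero, one_mul] at h
    rw [← h]; ring
  have hq : (1 : M2) - (1 / 2 : ℂ) • ((1 : M2) - σ₃) = !![1, 0; 0, 0] := by
    ext i j
    fin_cases i <;> fin_cases j <;> simp [σ₃] <;> norm_num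
  have hr : (1 / 2 : ℂ) • ((1 : M2) - σ₃) = !![0, 0; 0, 1] := by
    ext i j
    fin_cases i <;> fin_cases j <;> simp [σ₃] <;> norm_num
  rw [hq]
  rw [hr] at hne
  have hval : ∀ t : ℝ, 0 ≤ t → (ρ * T t p).trace =
      S t ρ 0 0 * p 0 0 + S t ρ 0 1 * p 1 0 + (S t ρ 1 0 * p 0 1 + S t ρ 1 1 * p 1 1) := by
    intro t ht
    rw [← hT t ht, Matrix.trace_fin_two, Matrix.mul_apply, Matrix.mul_apply,
      Fin.sum_univ_two, Fin.sum_univ_two]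
  constructor
  · intro hp
    have hn : 0 ≤ ρ 0 0 := hρ.1.diag_nonneg
    have hρ0 : ρ 0 0 ≠ 0 := by
      intro h0
      have h10 : ρ 1 0 = star (ρ 0 1) := (hρ.1.1.apply 1 0).symm
      have hd := hρ.1.det_nonneg
      rw [Matrix.det_fin_two, h0, h10] at hd
      have h01 : ρ 0 1 = 0 := by
        by_contra hcon
        have h2 : ρ 0 1 * star (ρ 0 1) = ((‖ρ 0 1‖ ^ 2 : ℝ) : ℂ) := by
          have := Complex.mul_conj' (ρ 0 1)
          rw [Complex.star_def, this]; push_cast; rfl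
        rw [h2, zero_mul, zero_sub, ← Complex.ofReal_neg] at hd
        have hd' : (0 : ℝ) ≤ -‖ρ 0 1‖ ^ 2 := by exact_mod_cast hd
        have : 0 < ‖ρ 0 1‖ := norm_pos_iff.mpr hcon
        nlinarith
      apply hne
      rw [h0, zero_add] at htr
      ext i j
      fin_cases i <;> fin_cases j <;> simp [h0, h01, h10, htr]
    have hapos : 0 < (ρ 0 0).re := by
      rcases Complex.le_def.mp hn with ⟨h1, h2⟩
      refine lt_of_le_of_ne (by simpa using h1) ?_
      intro h
      exact hρ0 (Complex.ext (by simpa using h.symm) (by simpa using h2.symm))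
    have hlim : Tendsto (fun t : ℝ => -η + t⁻¹ * Real.log (ρ 0 0).re) atTop (𝓝 (-η)) := by
      have := (tendsto_inv_atTop_zero (𝕜 := ℝ)).mul_const (Real.log (ρ 0 0).re)
      simpa using this.const_add (-η)
    refine hlim.congr' ?_
    filter_upwards [eventually_gt_atTop 0] with t ht
    have hv : (ρ * T t p).trace.re = Real.exp (-η * t) * (ρ 0 0).re := by
      rw [hval t ht.le, hp, s00]
      have : Complex.exp ((-η : ℂ) * t) = ((Real.exp (-η * t) : ℝ) : ℂ) := by push_cast; rfl
      rw [this]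
      simp [-Complex.ofReal_exp]
    rw [hv, Real.log_mul (Real.exp_pos _).ne' hapos.ne', Real.log_exp]
    field_simp
  · intro hp
    have e1 : p 1 0 * p 0 1 + p 1 1 * p 1 1 = p 1 1 := by
      have := congrFun (congrFun hpp 1) 1
      rwa [Matrix.mul_apply, Fin.sum_univ_two] at this
    have e0 : p 0 0 * p 0 0 + p 0 1 * p 1 0 = p 0 0 := by
      have := congrFun (congrFun hpp 0) 0
      rwa [Matrix.mul_apply, Fin.sum_univ_two] at this
    have h10 : p 1 0 = star (p 0 1) := (hpH.apply 1 0).symm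
    have h11 : star (p 1 1) = p 1 1 := hpH.apply 1 1
    have him : (p 1 1).im = 0 := Complex.conj_eq_iff_im.mp h11
    have hne0 : (p 1 1).re ≠ 0 := by
      intro hre
      have hz1 : p 1 1 = 0 := Complex.ext hre him
      rw [hz1, h10] at e1
      have h01 : p 0 1 = 0 := by simpa using e1
      rw [h01] at e0 h10
      have h10' : p 1 0 = 0 := by simpa using h10
      have h3 : p 0 0 = 0 ∨ p 0 0 = 1 := by
        have : p 0 0 * (p 0 0 - 1) = 0 := by linear_combination e0
        rcases mul_eq_zero.mp this with h | h
        · exact Or.inl h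
        · exact Or.inr (sub_eq_zero.mp h)
      rcases h3 with h | h
      · apply hp0
        ext i j
        fin_cases i <;> fin_cases j <;> simp [h, h01, h10', hz1]
      · apply hp
        ext i j
        fin_cases i <;> fin_cases j <;> simp [h, h01, h10', hz1]
    have t00 : Tendsto (fun t : ℝ => S t ρ 0 0) atTop (𝓝 0) := by
      simp_rw [s00]
      simpa using (exp_aux (-η : ℂ) (by simpa using hη)).mul_const (ρ 0 0)
    have t01 : Tendsto (fun t : ℝ => S t ρ 0 1) atTop (𝓝 0) := by
      simp_rw [s01]
      simpa using (exp_aux (-2 * Complex.I * ξ - η / 2 : ℂ) (by simp; exact hη)).mul_const (ρ 0 1)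
    have t10 : Tendsto (fun t : ℝ => S t ρ 1 0) atTop (𝓝 0) := by
      simp_rw [s10]
      simpa using (exp_aux (2 * Complex.I * ξ - η / 2 : ℂ) (by simp; exact hη)).mul_const (ρ 1 0)
    have t11 : Tendsto (fun t : ℝ => S t ρ 1 1) atTop (𝓝 1) := by
      simp_rw [s11]
      simpa using t00.const_sub 1
    have hlim := ((t00.mul_const (p 0 0)).add (t01.mul_const (p 1 0))).add
      ((t10.mul_const (p 0 1)).add (t11.mul_const (p 1 1)))
    simp only [zero_mul, zero_add, one_mul] at hlim
    have hlim2 : Tendsto (fun t : ℝ => (ρ * T t p).trace) atTop (𝓝 (p 1 1)) := by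
      refine hlim.congr' ?_
      filter_upwards [eventually_ge_atTop 0] with t ht
      exact (hval t ht).symm
    have hlim3 := ((Complex.continuous_re.tendsto _).comp hlim2).log hne0
    have := (tendsto_inv_atTop_zero (𝕜 := ℝ)).mul hlim3
    simpa using this
end
end
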